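/- arXiv:1903.09625 — 5 statements merged into one kernel-verified Lean document; each statement's English description precedes it below -/
import Mathlib

section
/- Let χ be a finite alphabet and P = [p_{ij}] an irreducible and aperiodic stochastic matrix on χ with (unique) stationary distribution π_μ; let μ be the stationary Markov measure on χ^ℕ. Then for every Markov measure ν on χ^ℕ with arbitrary initial distribution π and transition matrix P, the Rényi entropy H₂(ν) exists and H₂(ν) = H₂(μ) = −log p, where p is the largest eigenvalue of the matrix [(p_{ij})²]. -/
open MeasureTheory Filter

/-- The sum over all `k`-cylinders of the squared measure of the cylinder. -/
noncomputable def renyiSum {χ : Type*} [Fintype χ] [MeasurableSpace χ]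
    (Q : Measure (ℕ → χ)) (k : ℕ) : ℝ :=
  ∑ w : Fin k → χ, ((Q {z | ∀ i : Fin k, z (i : ℕ) = w i}).toReal) ^ 2

/-- Lower Rényi entropy `H̲₂(Q) = -liminf (1/k) log ∑_{C_k} Q(C_k)²`. -/
noncomputable def lowerRenyi {χ : Type*} [Fintype χ] [MeasurableSpace χ]
    (Q : Measure (ℕ → χ)) : ℝ :=
  -Filter.liminf (fun k : ℕ => (1 / (k : ℝ)) * Real.log (renyiSum Q k)) Filter.atTop

/-- Upper Rényi entropy `H̄₂(Q) = -limsup (1/k) log ∑_{C_k} Q(C_k)²`. -/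
noncomputable def upperRenyi {χ : Type*} [Fintype χ] [MeasurableSpace χ]
    (Q : Measure (ℕ → χ)) : ℝ :=
  -Filter.limsup (fun k : ℕ => (1 / (k : ℝ)) * Real.log (renyiSum Q k)) Filter.atTop

/-- `ν` is the Markov measure with initial distribution `π` and transition matrix `P`:
every `(n+1)`-cylinder `[w₀ … w_n]` has mass `π(w₀) ∏ P(wᵢ, wᵢ₊₁)`. -/
def IsMarkovMeasure {χ : Type*} [Fintype χ] [MeasurableSpace χ]
    (ν : Measure (ℕ → χ)) (π : χ → ℝ) (P : Matrix χ χ ℝ) : Prop :=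
  ∀ (n : ℕ) (w : ℕ → χ),
    (ν {z | ∀ i ≤ n, z i = w i}).toReal
      = π (w 0) * ∏ i ∈ Finset.range n, P (w i) (w (i + 1))

/-- The entrywise square of a nonnegative matrix is positive in a power as soon as the matrix is. -/
lemma pow_sq_entries_pos {χ : Type*} [Fintype χ] [DecidableEq χ] {P : Matrix χ χ ℝ}
    (hP : ∀ i j, 0 ≤ P i j) (n : ℕ) (i j : χ) (h : 0 < (P ^ n) i j) :
    0 < ((Matrix.of fun i j => (P i j) ^ 2) ^ n : Matrix χ χ ℝ) i j := by
  induction n generalizing j with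
  | zero => simpa using h
  | succ n ih =>
    have hA : ∀ i j, 0 ≤ (Matrix.of fun i j => (P i j) ^ 2 : Matrix χ χ ℝ) i j :=
      fun i j => sq_nonneg _
    rw [pow_succ, Matrix.mul_apply] at h ⊢
    obtain ⟨k, -, hk⟩ := Finset.exists_lt_of_sum_lt
      (s := Finset.univ) (f := fun _ => (0 : ℝ)) (g := fun k => (P ^ n) i k * P k j)
      (by simpa using h)
    have hPk : 0 < P k j := (hP k j).lt_of_ne fun h0 => by simp [← h0] at hk
    refine Finset.sum_pos' (fun l _ => mul_nonneg (Matrix.pow_apply_nonneg hA n i l) (hA l j))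
      ⟨k, Finset.mem_univ k, mul_pos (ih k (pos_of_mul_pos_left hk hPk.le)) ?_⟩
    exact pow_pos hPk 2

/-- Multiplying a nonzero nonnegative vector by a positive matrix gives a positive vector. -/
lemma mulVec_pos_of_pos {χ : Type*} [Fintype χ] {B : Matrix χ χ ℝ} (hB : ∀ i j, 0 < B i j)
    {x : χ → ℝ} (hx : ∀ i, 0 ≤ x i) (hx0 : ∃ i, x i ≠ 0) (i : χ) : 0 < B.mulVec x i := by
  obtain ⟨j, hj⟩ := hx0
  exact Finset.sum_pos' (fun l _ => mul_nonneg (hB i l).le (hx l))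
    ⟨j, Finset.mem_univ j, mul_pos (hB i j) ((hx j).lt_of_ne' hj)⟩

lemma pow_mulVec_of_mulVec_eq_smul {χ : Type*} [Fintype χ] [DecidableEq χ] {A : Matrix χ χ ℝ}
    {r : ℝ} {v : χ → ℝ} (h : A.mulVec v = r • v) (n : ℕ) : (A ^ n).mulVec v = r ^ n • v := by
  induction n with
  | zero => simp
  | succ n ih =>
    rw [pow_succ, ← Matrix.mulVec_mulVec, h, Matrix.mulVec_smul, ih, smul_smul, pow_succ']

/-- Existence of a Perron eigenvector of a primitive matrix, by maximizing `t` subject to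
`t • x ≤ A x` over the simplex. -/
lemma exists_pos_eigenvector {χ : Type*} [Fintype χ] [DecidableEq χ] [Nonempty χ]
    {A : Matrix χ χ ℝ} (hA : ∀ i j, 0 ≤ A i j) {n : ℕ} (hn : 0 < n) (hAn : ∀ i j, 0 < (A ^ n) i j) :
    ∃ (r : ℝ) (v : χ → ℝ), 0 < r ∧ (∀ i, 0 < v i) ∧ A.mulVec v = r • v := by
  set M : ℝ := ∑ i, ∑ j, A i j with hM
  have hM0 : 0 ≤ M := Finset.sum_nonneg fun i _ => Finset.sum_nonneg fun j _ => hA i j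
  let K : Set (ℝ × (χ → ℝ)) :=
    (Set.Icc 0 M ×ˢ stdSimplex ℝ χ) ∩ {q | ∀ i, q.1 * q.2 i ≤ A.mulVec q.2 i}
  have hclosed : IsClosed {q : ℝ × (χ → ℝ) | ∀ i, q.1 * q.2 i ≤ A.mulVec q.2 i} := by
    rw [Set.ofPred_forall]
    refine isClosed_iInter fun i => isClosed_le (by fun_prop) ?_
    simp only [Matrix.mulVec, dotProduct]
    fun_prop
  have hK : IsCompact K :=
    (isCompact_Icc.prod (isCompact_stdSimplex ℝ χ)).inter_right hclosed
  have hmul_nonneg : ∀ x : χ → ℝ, (∀ i, 0 ≤ x i) → ∀ i, 0 ≤ A.mulVec x i :=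
    fun x hx i => Finset.sum_nonneg fun j _ => mul_nonneg (hA i j) (hx j)
  have hKne : K.Nonempty := by
    let i₀ := Classical.arbitrary χ
    refine ⟨(0, Pi.single i₀ 1), ⟨⟨le_rfl, hM0⟩, single_mem_stdSimplex ℝ i₀⟩, fun i => ?_⟩
    simpa using hA i i₀
  obtain ⟨⟨r, x⟩, ⟨⟨⟨hr0, -⟩, hx⟩, hrx⟩, hmax⟩ := hK.exists_isMaxOn hKne continuous_fst.continuousOn
  simp only at hr0 hx hrx
  have hx0 : ∃ i, x i ≠ 0 := by
    by_contra! h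
    have := hx.2
    simp [h] at this
  have hle : ∀ (t : ℝ) (y : χ → ℝ), 0 ≤ t → (∀ i, 0 < y i) →
      (∀ i, t * y i ≤ A.mulVec y i) → t ≤ r := by
    intro t y ht hy hty
    have hs : 0 < ∑ i, y i := Finset.sum_pos (fun i _ => hy i) Finset.univ_nonempty
    set z : χ → ℝ := (∑ i, y i)⁻¹ • y with hz
    have hz1 : z ∈ stdSimplex ℝ χ := by
      refine ⟨fun i => mul_nonneg (inv_nonneg.2 hs.le) (hy i).le, ?_⟩
      simp only [hz, Pi.smul_apply, smul_eq_mul, ← Finset.mul_sum]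
      exact inv_mul_cancel₀ hs.ne'
    have htz : ∀ i, t * z i ≤ A.mulVec z i := by
      intro i
      rw [hz, Matrix.mulVec_smul, Pi.smul_apply, Pi.smul_apply, smul_eq_mul, smul_eq_mul,
        mul_left_comm]
      exact mul_le_mul_of_nonneg_left (hty i) (inv_nonneg.2 hs.le)
    have htM : t ≤ M := calc
      t = ∑ i, t * z i := by rw [← Finset.mul_sum, hz1.2, mul_one]
      _ ≤ ∑ i, A.mulVec z i := Finset.sum_le_sum fun i _ => htz i
      _ ≤ M := Finset.sum_le_sum fun i _ => Finset.sum_le_sum fun j _ =>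
        mul_le_of_le_one_right (hA i j)
          (hz1.2 ▸ Finset.single_le_sum (fun l _ => hz1.1 l) (Finset.mem_univ j))
    exact hmax (show (t, z) ∈ K from ⟨⟨⟨ht, htM⟩, hz1⟩, htz⟩)
  have heig : A.mulVec x = r • x := by
    by_contra hne
    obtain ⟨i₀, hi₀⟩ := Function.ne_iff.1 hne
    have hy : ∀ i, 0 < (A ^ n).mulVec x i := mulVec_pos_of_pos hAn hx.1 hx0
    have hgap : ∀ i, 0 < (A ^ n).mulVec (A.mulVec x - r • x) i :=
      mulVec_pos_of_pos hAn (fun i => sub_nonneg.2 (hrx i)) ⟨i₀, sub_ne_zero.2 hi₀⟩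
    set y := (A ^ n).mulVec x with hydef
    have hgap' : ∀ i, r < A.mulVec y i / y i := by
      intro i
      have h := hgap i
      rw [Matrix.mulVec_sub, Matrix.mulVec_smul, Matrix.mulVec_mulVec, ← pow_succ, pow_succ',
        ← Matrix.mulVec_mulVec, ← hydef] at h
      rw [lt_div_iff₀ (hy i)]
      simpa using h
    obtain ⟨i, hi⟩ := Finite.exists_min fun i => A.mulVec y i / y i
    refine (hgap' i).not_ge (hle _ y (hr0.trans (hgap' i).le) hy fun j => ?_)
    exact (le_div_iff₀ (hy j)).1 (hi j)
  have hpos : ∀ i, 0 < r ^ n * x i := by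
    intro i
    have h := mulVec_pos_of_pos hAn hx.1 hx0 i
    rwa [pow_mulVec_of_mulVec_eq_smul heig] at h
  refine ⟨r, x, hr0.lt_of_ne' fun h => ?_, fun i => (hx.1 i).lt_of_ne' fun h => ?_, heig⟩
  · have := hpos (Classical.arbitrary χ)
    simp [h, hn.ne'] at this
  · have := hpos i
    simp [h] at this

lemma mem_spectrum_iff_exists_mulVec {χ : Type*} [Fintype χ] [DecidableEq χ] {A : Matrix χ χ ℝ}
    {q : ℝ} : q ∈ spectrum ℝ A ↔ ∃ w : χ → ℝ, w ≠ 0 ∧ A.mulVec w = q • w := by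
  rw [← Matrix.spectrum_toLin', ← Module.End.hasEigenvalue_iff_mem_spectrum]
  constructor
  · intro h
    obtain ⟨w, hw⟩ := h.exists_hasEigenvector
    exact ⟨w, hw.2, by simpa using hw.apply_eq_smul⟩
  · rintro ⟨w, hw0, hw⟩
    exact Module.End.hasEigenvalue_of_hasEigenvector (x := w) (Module.End.hasEigenvector_iff.2
      ⟨Module.End.mem_eigenspace_iff.2 (by simpa using hw), hw0⟩)

/-- The eigenvalue of a positive eigenvector of a nonnegative matrix dominates every real
eigenvalue. -/
lemma le_of_pos_eigenvector {χ : Type*} [Fintype χ] {A : Matrix χ χ ℝ}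
    (hA : ∀ i j, 0 ≤ A i j) {r q : ℝ} {v w : χ → ℝ} (hv : ∀ i, 0 < v i)
    (hAv : A.mulVec v = r • v) (hw : w ≠ 0) (hAw : A.mulVec w = q • w) : q ≤ r := by
  obtain ⟨j, hj⟩ := Function.ne_iff.1 hw
  have : Nonempty χ := ⟨j⟩
  obtain ⟨i, hi⟩ := Finite.exists_max fun i => |w i| / v i
  set c := |w i| / v i with hc
  have hc0 : 0 < c := (div_pos (abs_pos.2 hj) (hv j)).trans_le (hi j)
  have hwi : |w i| = c * v i := by rw [hc, div_mul_cancel₀ _ (hv i).ne']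
  have key : |q| * (c * v i) ≤ r * (c * v i) := calc
    |q| * (c * v i) = |A.mulVec w i| := by
      rw [hAw, Pi.smul_apply, smul_eq_mul, abs_mul, hwi]
    _ ≤ ∑ j, |A i j * w j| := Finset.abs_sum_le_sum_abs _ _
    _ ≤ ∑ j, c * (A i j * v j) := by
      refine Finset.sum_le_sum fun j _ => ?_
      rw [abs_mul, abs_of_nonneg (hA i j), mul_left_comm]
      exact mul_le_mul_of_nonneg_left ((div_le_iff₀ (hv j)).1 (hi j)) (hA i j)
    _ = c * A.mulVec v i := by rw [← Finset.mul_sum]; rfl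
    _ = r * (c * v i) := by rw [hAv, Pi.smul_apply, smul_eq_mul, mul_left_comm]
  exact (le_abs_self q).trans (le_of_mul_le_mul_right key (mul_pos hc0 (hv i)))

/-- Summing path weights over all paths of length `k` computes a matrix power. -/
lemma sum_paths_eq_vecMul_pow {χ : Type*} [Fintype χ] [DecidableEq χ] (A : Matrix χ χ ℝ) (k : ℕ)
    (g : χ → ℝ) :
    ∑ w : Fin (k + 1) → χ, g (w 0) * ∏ i : Fin k, A (w i.castSucc) (w i.succ)
      = g ⬝ᵥ (A ^ k).mulVec 1 := by
  induction k generalizing g with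
  | zero =>
    rw [← (Equiv.funUnique (Fin 1) χ).symm.sum_comp]
    simp [dotProduct]
  | succ k ih =>
    rw [pow_succ', ← Matrix.mulVec_mulVec, Matrix.dotProduct_mulVec, ← ih,
      ← (Fin.consEquiv fun _ : Fin (k + 2) => χ).sum_comp, Fintype.sum_prod_type, Finset.sum_comm]
    refine Finset.sum_congr rfl fun w _ => ?_
    simp [Fin.prod_univ_succ, Fin.consEquiv, Matrix.vecMul, dotProduct, Finset.sum_mul, mul_assoc]

lemma renyiSum_succ_of_isMarkovMeasure {χ : Type*} [Fintype χ] [DecidableEq χ] [MeasurableSpace χ]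
    {ν : Measure (ℕ → χ)} {π : χ → ℝ} {P : Matrix χ χ ℝ} (hν : IsMarkovMeasure ν π P) (k : ℕ) :
    renyiSum ν (k + 1)
      = (fun i => π i ^ 2) ⬝ᵥ ((Matrix.of fun i j => (P i j) ^ 2) ^ k : Matrix χ χ ℝ).mulVec 1 := by
  rw [← sum_paths_eq_vecMul_pow, renyiSum]
  refine Finset.sum_congr rfl fun w _ => ?_
  let w' : ℕ → χ := fun i => w (Fin.ofNat (k + 1) i)
  have hw' : ∀ i : Fin (k + 1), w' i = w i := fun i => by simp [w']
  have hset : {z : ℕ → χ | ∀ i : Fin (k + 1), z i = w i} = {z | ∀ i ≤ k, z i = w' i} := by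
    ext z
    simp only [Set.mem_ofPred_eq, ← hw', Fin.forall_iff, Nat.lt_succ_iff]
  rw [hset, hν k w', mul_pow, Finset.prod_range, ← Finset.prod_pow]
  congr 1
  refine Finset.prod_congr rfl fun i _ => ?_
  rw [Matrix.of_apply, ← hw', ← hw', Fin.val_castSucc, Fin.val_succ]

lemma tendsto_log_div_of_geometric_bounds {S : ℕ → ℝ} {c C r : ℝ} (hc : 0 < c) (hr : 0 < r)
    (hlow : ∀ k, c * r ^ k ≤ S (k + 1)) (hup : ∀ k, S (k + 1) ≤ C * r ^ k) :
    Tendsto (fun k : ℕ => (1 / (k : ℝ)) * Real.log (S k)) atTop (nhds (Real.log r)) := by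
  have hC : 0 < C := hc.trans_le (by simpa using (hlow 0).trans (hup 0))
  have hlim : ∀ a : ℝ, Tendsto (fun k : ℕ => a / ((k + 1 : ℕ) : ℝ) + Real.log r) atTop
      (nhds (Real.log r)) := fun a => by
    simpa using ((tendsto_const_div_atTop_nhds_zero_nat a).comp
      (tendsto_add_atTop_nat 1)).add_const (Real.log r)
  have hlog : ∀ (a : ℝ) (k : ℕ), 0 < a → Real.log (a * r ^ k)
      = (Real.log a - Real.log r) + ((k + 1 : ℕ) : ℝ) * Real.log r := fun a k ha => by
    rw [Real.log_mul ha.ne' (pow_pos hr k).ne', Real.log_pow]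
    push_cast
    ring
  rw [← tendsto_add_atTop_iff_nat 1]
  refine tendsto_of_tendsto_of_tendsto_of_le_of_le (hlim (Real.log c - Real.log r))
    (hlim (Real.log C - Real.log r)) (fun k => ?_) fun k => ?_
  all_goals
    have hk : (0 : ℝ) < ((k + 1 : ℕ) : ℝ) := by positivity
    have hl : 0 < c * r ^ k := mul_pos hc (pow_pos hr k)
    dsimp only
    rw [div_add' _ _ _ hk.ne', one_div_mul_eq_div, mul_comm (Real.log r), ← hlog _ k (by assumption)]
    refine div_le_div_of_nonneg_right (Real.log_le_log ?_ ?_) hk.le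
  exacts [hl, hlow k, hl.trans_le (hlow k), hup k]

/-- A positive eigenvector determines the growth rate of `g ⬝ᵥ A ^ k 1` up to constants. -/
lemma tendsto_log_dotProduct_pow {χ : Type*} [Fintype χ] [DecidableEq χ] [Nonempty χ]
    {A : Matrix χ χ ℝ} (hA : ∀ i j, 0 ≤ A i j) {r : ℝ} {v : χ → ℝ} (hr : 0 < r)
    (hv : ∀ i, 0 < v i) (hAv : A.mulVec v = r • v) {g : χ → ℝ} (hg : ∀ i, 0 ≤ g i)
    (hg0 : ∃ i, g i ≠ 0) {S : ℕ → ℝ} (hS : ∀ k, S (k + 1) = g ⬝ᵥ (A ^ k).mulVec 1) :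
    Tendsto (fun k : ℕ => (1 / (k : ℝ)) * Real.log (S k)) atTop (nhds (Real.log r)) := by
  obtain ⟨a, ha⟩ := Finite.exists_min v
  obtain ⟨b, hb⟩ := Finite.exists_max v
  have hgv : 0 < g ⬝ᵥ v := by
    obtain ⟨i, hi⟩ := hg0
    exact Finset.sum_pos' (fun l _ => mul_nonneg (hg l) (hv l).le)
      ⟨i, Finset.mem_univ i, mul_pos ((hg i).lt_of_ne' hi) (hv i)⟩
  have hmono : ∀ (k : ℕ) (x y : χ → ℝ), (∀ i, x i ≤ y i) →
      g ⬝ᵥ (A ^ k).mulVec x ≤ g ⬝ᵥ (A ^ k).mulVec y := fun k x y hxy =>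
    Finset.sum_le_sum fun i _ => mul_le_mul_of_nonneg_left (Finset.sum_le_sum fun j _ =>
      mul_le_mul_of_nonneg_left (hxy j) (Matrix.pow_apply_nonneg hA k i j)) (hg i)
  have hpow : ∀ k, g ⬝ᵥ (A ^ k).mulVec v = g ⬝ᵥ v * r ^ k := fun k => by
    rw [pow_mulVec_of_mulVec_eq_smul hAv, dotProduct_smul, smul_eq_mul, mul_comm]
  have hconst : ∀ (k : ℕ) (t : ℝ), g ⬝ᵥ (A ^ k).mulVec (t • 1) = S (k + 1) * t := fun k t => by
    rw [Matrix.mulVec_smul, dotProduct_smul, smul_eq_mul, hS, mul_comm]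
  refine tendsto_log_div_of_geometric_bounds (c := g ⬝ᵥ v / v b) (C := g ⬝ᵥ v / v a)
    (div_pos hgv (hv b)) hr (fun k => ?_) fun k => ?_
  · rw [div_mul_eq_mul_div, div_le_iff₀ (hv b), ← hpow, ← hconst]
    exact hmono k _ _ fun i => by simpa using hb i
  · rw [div_mul_eq_mul_div, le_div_iff₀ (hv a), ← hpow, ← hconst]
    exact hmono k _ _ fun i => by simpa using ha i

/-- for an irreducible aperiodic Markov chain, the Rényi entropy of any Markov
measure `ν` with transition matrix `P` exists and equals that of the stationary measure `μ`,
namely `-log p` with `p` the largest eigenvalue of `[(p_{ij})²]`. Existence and the value of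
`H₂` are expressed as `(1/k) log ∑_{C_k} Q(C_k)² → log p` (so `H₂(Q) = -log p`). -/
theorem renyi_entropy_markov_initial_distribution
    {χ : Type*} [Fintype χ] [DecidableEq χ] [Nonempty χ] [MeasurableSpace χ]
    (P : Matrix χ χ ℝ) (hPnn : ∀ i j, 0 ≤ P i j) (hProw : ∀ i, ∑ j, P i j = 1)
    (hprim : ∃ n : ℕ, 0 < n ∧ ∀ i j, 0 < (P ^ n) i j)
    (πμ : χ → ℝ) (hπμnn : ∀ i, 0 ≤ πμ i) (hπμsum : ∑ i, πμ i = 1)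
    (hstat : ∀ j, ∑ i, πμ i * P i j = πμ j)
    (π : χ → ℝ) (hπnn : ∀ i, 0 ≤ π i) (hπsum : ∑ i, π i = 1)
    (μ ν : Measure (ℕ → χ)) [IsProbabilityMeasure μ] [IsProbabilityMeasure ν]
    (hμ : IsMarkovMeasure μ πμ P) (hν : IsMarkovMeasure ν π P)
    (p : ℝ) (hpe : p ∈ spectrum ℝ (Matrix.of fun i j => (P i j) ^ 2))
    (hpmax : ∀ q ∈ spectrum ℝ (Matrix.of fun i j => (P i j) ^ 2), q ≤ p) :
    Filter.Tendsto (fun k : ℕ => (1 / (k : ℝ)) * Real.log (renyiSum ν k))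
        Filter.atTop (nhds (Real.log p)) ∧
    Filter.Tendsto (fun k : ℕ => (1 / (k : ℝ)) * Real.log (renyiSum μ k))
        Filter.atTop (nhds (Real.log p)) := by
  obtain ⟨n, hn, hPn⟩ := hprim
  have hA : ∀ i j, 0 ≤ (Matrix.of fun i j => (P i j) ^ 2 : Matrix χ χ ℝ) i j :=
    fun i j => sq_nonneg _
  obtain ⟨r, v, hr, hv, hAv⟩ := exists_pos_eigenvector hA hn
    fun i j => pow_sq_entries_pos hPnn n i j (hPn i j)
  have hv0 : v ≠ 0 := fun h => (hv (Classical.arbitrary χ)).ne' (congrFun h _)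
  obtain ⟨w, hw0, hAw⟩ := mem_spectrum_iff_exists_mulVec.1 hpe
  have hpr : p = r := le_antisymm (le_of_pos_eigenvector hA hv hAv hw0 hAw)
    (hpmax r (mem_spectrum_iff_exists_mulVec.2 ⟨v, hv0, hAv⟩))
  have hlim : ∀ (Q : Measure (ℕ → χ)) (ρ : χ → ℝ), ∑ i, ρ i = 1 → IsMarkovMeasure Q ρ P →
      Tendsto (fun k : ℕ => (1 / (k : ℝ)) * Real.log (renyiSum Q k)) atTop
        (nhds (Real.log p)) := by
    intro Q ρ hρ hQ
    rw [hpr]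
    refine tendsto_log_dotProduct_pow hA hr hv hAv (fun i => sq_nonneg (ρ i)) ?_
      (renyiSum_succ_of_isMarkovMeasure hQ)
    by_contra! h
    have h0 : ∀ i, ρ i = 0 := fun i => pow_eq_zero_iff two_ne_zero |>.1 (h i)
    simp [h0] at hρ
  exact ⟨hlim ν π hπsum hν, hlim μ πμ hπμsum hμ⟩
end

section
/- Let χ be a finite alphabet, P = [p_{ij}] an irreducible and aperiodic stochastic matrix on χ with stationary distribution π_μ, μ the stationary Markov measure on χ^ℕ, and suppose the Rényi entropy H₂(μ) exists (the limit defining it exists and equals h). Then for every Markov measure ν with arbitrary initial distribution π and transition matrix P, the upper Rényi entropy satisfies H̄₂(ν) ≤ h. -/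
open MeasureTheory Filter

open Matrix in
/-- Summing the weights `f (w 0) * ∏ Q (w i) (w (i + 1))` over all words of length `n + 1`. -/
lemma sum_path_weight {χ : Type*} [Fintype χ] [DecidableEq χ] (Q : Matrix χ χ ℝ) (n : ℕ)
    (f : χ → ℝ) :
    ∑ w : Fin (n + 1) → χ, f (w 0) * ∏ i : Fin n, Q (w i.castSucc) (w i.succ)
      = ∑ x, f x * ((Q ^ n) *ᵥ 1) x := by
  induction n generalizing f with
  | zero =>
    rw [← (Equiv.funUnique (Fin 1) χ).symm.sum_comp]
    simp
  | succ n ih =>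
    rw [← (Fin.consEquiv fun _ => χ).sum_comp, Fintype.sum_prod_type]
    refine Finset.sum_congr rfl fun a _ => ?_
    have := ih (fun x => f a * Q a x)
    simp only [Fin.consEquiv_apply, Fin.cons_zero, Fin.prod_univ_succ, Fin.castSucc_zero,
      Fin.cons_succ, ← Fin.succ_castSucc, ← mul_assoc] at this ⊢
    rw [this, pow_succ', ← Matrix.mulVec_mulVec]
    simp only [Matrix.mulVec, dotProduct, Finset.mul_sum, mul_assoc]

open Matrix in
/-- The Rényi sum of a Markov measure in terms of the entrywise square of its transition matrix. -/
lemma IsMarkovMeasure.renyiSum_succ {χ : Type*} [Fintype χ] [DecidableEq χ] [MeasurableSpace χ]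
    {ν : Measure (ℕ → χ)} {π : χ → ℝ} {P : Matrix χ χ ℝ} (hν : IsMarkovMeasure ν π P) (n : ℕ) :
    renyiSum ν (n + 1) = ∑ x, π x ^ 2 * (((P ⊙ P) ^ n) *ᵥ 1) x := by
  rw [← sum_path_weight (P ⊙ P) n (fun x => π x ^ 2), renyiSum]
  refine Finset.sum_congr rfl fun w _ => ?_
  have key := hν n (fun i => w (Fin.ofNat (n + 1) i))
  have hset : {z : ℕ → χ | ∀ i : Fin (n + 1), z (i : ℕ) = w i}
      = {z | ∀ i ≤ n, z i = w (Fin.ofNat (n + 1) i)} := by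
    ext z
    refine ⟨fun hz i hi => ?_, fun hz i => ?_⟩
    · rw [← hz]
      simp [Nat.mod_eq_of_lt (Nat.lt_succ_of_le hi)]
    · rw [hz i (Nat.le_of_lt_succ i.2)]
      simp
  rw [hset, key, mul_pow, ← Finset.prod_pow, Finset.prod_range]
  congr 1
  refine Finset.prod_congr rfl fun i _ => ?_
  have h₁ : Fin.ofNat (n + 1) (i : ℕ) = i.castSucc := by
    ext; simp
  have h₂ : Fin.ofNat (n + 1) ((i : ℕ) + 1) = i.succ := by
    ext; simp
  rw [h₁, h₂, Matrix.hadamard_apply, sq]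

open Matrix in
lemma hadamard_self_pow_nonneg {χ : Type*} [Fintype χ] [DecidableEq χ] (P : Matrix χ χ ℝ)
    (n : ℕ) (i j : χ) : 0 ≤ ((P ⊙ P) ^ n) i j := by
  induction n generalizing j with
  | zero => rw [pow_zero, Matrix.one_apply]; split_ifs <;> norm_num
  | succ n ih =>
    rw [pow_succ, Matrix.mul_apply]
    exact Finset.sum_nonneg fun k _ => mul_nonneg (ih k) (mul_self_nonneg _)

open Matrix in
lemma hadamard_self_pow_pos {χ : Type*} [Fintype χ] [DecidableEq χ] {P : Matrix χ χ ℝ}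
    {n : ℕ} {i j : χ} (hn : (P ^ n) i j ≠ 0) : 0 < ((P ⊙ P) ^ n) i j := by
  induction n generalizing j with
  | zero =>
    rw [pow_zero, Matrix.one_apply] at hn ⊢
    split_ifs at hn ⊢ <;> simp_all
  | succ n ih =>
    rw [pow_succ, Matrix.mul_apply] at hn ⊢
    obtain ⟨k, hk, hk0⟩ := Finset.exists_ne_zero_of_sum_ne_zero hn
    exact Finset.sum_pos'
      (fun l _ => mul_nonneg (hadamard_self_pow_nonneg P n i l) (mul_self_nonneg _))
      ⟨k, hk, mul_pos (ih (left_ne_zero_of_mul hk0))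
        (mul_self_pos.2 (right_ne_zero_of_mul hk0))⟩

open Matrix in
lemma hadamard_self_pow_mulVec_one_mem_Ioc {χ : Type*} [Fintype χ] [DecidableEq χ]
    {P : Matrix χ χ ℝ} (hPnn : ∀ i j, 0 ≤ P i j) (hProw : ∀ i, ∑ j, P i j = 1)
    (n : ℕ) (i : χ) : (((P ⊙ P) ^ n) *ᵥ 1) i ∈ Set.Ioc (0 : ℝ) 1 := by
  induction n generalizing i with
  | zero => simp
  | succ n ih =>
    rw [pow_succ', ← Matrix.mulVec_mulVec]
    constructor
    · obtain ⟨k, hk, hk0⟩ : ∃ k ∈ Finset.univ, P i k ≠ 0 :=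
        Finset.exists_ne_zero_of_sum_ne_zero (by rw [hProw i]; exact one_ne_zero)
      exact Finset.sum_pos' (fun l _ => mul_nonneg (mul_self_nonneg _) (ih l).1.le)
        ⟨k, hk, mul_pos (mul_self_pos.2 hk0) (ih k).1⟩
    · rw [← hProw i]
      refine Finset.sum_le_sum fun j _ => ?_
      have hle : P i j ≤ 1 := by
        rw [← hProw i]
        exact Finset.single_le_sum (fun l _ => hPnn i l) (Finset.mem_univ j)
      change P i j * P i j * _ ≤ _
      have := mul_le_of_le_one_right (mul_nonneg (hPnn i j) (hPnn i j)) (ih j).2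
      nlinarith [hPnn i j]

lemma sq_le_self_of_sum_eq_one {χ : Type*} [Fintype χ] {π : χ → ℝ} (hπnn : ∀ i, 0 ≤ π i)
    (hπsum : ∑ i, π i = 1) (i : χ) : π i ^ 2 ≤ π i := by
  have : π i ≤ 1 := by
    rw [← hπsum]
    exact Finset.single_le_sum (fun l _ => hπnn l) (Finset.mem_univ i)
  nlinarith [hπnn i]

/-- The Rényi sums of a Markov measure are positive and at most one. -/
lemma IsMarkovMeasure.renyiSum_succ_mem_Ioc {χ : Type*} [Fintype χ] [MeasurableSpace χ]
    {ν : Measure (ℕ → χ)} {π : χ → ℝ} {P : Matrix χ χ ℝ} (hν : IsMarkovMeasure ν π P)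
    (hPnn : ∀ i j, 0 ≤ P i j) (hProw : ∀ i, ∑ j, P i j = 1)
    (hπnn : ∀ i, 0 ≤ π i) (hπsum : ∑ i, π i = 1) (n : ℕ) :
    renyiSum ν (n + 1) ∈ Set.Ioc (0 : ℝ) 1 := by
  classical
  have hu := hadamard_self_pow_mulVec_one_mem_Ioc hPnn hProw n
  rw [hν.renyiSum_succ]
  constructor
  · obtain ⟨k, hk, hk0⟩ : ∃ k ∈ Finset.univ, π k ≠ 0 :=
      Finset.exists_ne_zero_of_sum_ne_zero (by rw [hπsum]; exact one_ne_zero)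
    exact Finset.sum_pos' (fun l _ => mul_nonneg (sq_nonneg _) (hu l).1.le)
      ⟨k, hk, mul_pos (by positivity) (hu k).1⟩
  · rw [← hπsum]
    exact Finset.sum_le_sum fun j _ =>
      (mul_le_of_le_one_right (sq_nonneg _) (hu j).2).trans
        (sq_le_self_of_sum_eq_one hπnn hπsum j)

open Matrix in
/-- If `P ^ N` is entrywise positive, the Rényi sums of any Markov measure with transition matrix
`P` dominate, after a shift by `N` and up to a constant, those of any other one. -/
lemma IsMarkovMeasure.exists_mul_renyiSum_le {χ : Type*} [Fintype χ] [DecidableEq χ]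
    [MeasurableSpace χ] {P : Matrix χ χ ℝ} (hPnn : ∀ i j, 0 ≤ P i j)
    (hProw : ∀ i, ∑ j, P i j = 1) {N : ℕ} (hN : ∀ i j, 0 < (P ^ N) i j)
    {ρ π : χ → ℝ} (hρnn : ∀ i, 0 ≤ ρ i) (hρsum : ∑ i, ρ i = 1) (hπsum : ∑ i, π i = 1)
    {μ ν : Measure (ℕ → χ)} (hμ : IsMarkovMeasure μ ρ P) (hν : IsMarkovMeasure ν π P) :
    ∃ c : ℝ, 0 < c ∧ ∀ n, c * renyiSum μ (n + 1) ≤ renyiSum ν (n + 1 + N) := by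
  obtain ⟨k, -, hk0⟩ : ∃ k ∈ Finset.univ, π k ≠ 0 :=
    Finset.exists_ne_zero_of_sum_ne_zero (by rw [hπsum]; exact one_ne_zero)
  have : Nonempty χ := ⟨k⟩
  obtain ⟨j, hj⟩ := Finite.exists_min fun j => ((P ⊙ P) ^ N) k j
  have hpos : 0 < ((P ⊙ P) ^ N) k j := hadamard_self_pow_pos (hN k j).ne'
  refine ⟨π k ^ 2 * ((P ⊙ P) ^ N) k j, by positivity, fun n => ?_⟩
  have hu := hadamard_self_pow_mulVec_one_mem_Ioc hPnn hProw
  rw [show n + 1 + N = (N + n) + 1 by ring, hμ.renyiSum_succ, hν.renyiSum_succ, mul_assoc]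
  refine le_trans ?_ (Finset.single_le_sum
    (f := fun x => π x ^ 2 * (((P ⊙ P) ^ (N + n)) *ᵥ 1) x)
    (fun l _ => mul_nonneg (sq_nonneg _) (hu _ l).1.le) (Finset.mem_univ k))
  refine mul_le_mul_of_nonneg_left ?_ (sq_nonneg _)
  rw [pow_add, ← Matrix.mulVec_mulVec, Finset.mul_sum]
  refine Finset.sum_le_sum fun i _ => mul_le_mul (hj i) ?_
    (mul_nonneg (sq_nonneg _) (hu n i).1.le) (hpos.le.trans (hj i))
  have hρ1 : ρ i ≤ 1 := by
    rw [← hρsum]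
    exact Finset.single_le_sum (fun l _ => hρnn l) (Finset.mem_univ i)
  exact mul_le_of_le_one_left (hu n i).1.le (pow_le_one₀ (hρnn i) hρ1)

/-- if the Rényi entropy of the stationary Markov measure `μ` exists and
equals `h` (i.e. `(1/k) log ∑_{C_k} μ(C_k)² → -h`), then for any Markov measure `ν` with the
same (irreducible, aperiodic) transition matrix, `H̄₂(ν) ≤ h`. -/
theorem renyi_entropy_markov_upper_le
    {χ : Type*} [Fintype χ] [DecidableEq χ] [Nonempty χ] [MeasurableSpace χ]
    (P : Matrix χ χ ℝ) (hPnn : ∀ i j, 0 ≤ P i j) (hProw : ∀ i, ∑ j, P i j = 1)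
    (hprim : ∃ n : ℕ, 0 < n ∧ ∀ i j, 0 < (P ^ n) i j)
    (πμ : χ → ℝ) (hπμnn : ∀ i, 0 ≤ πμ i) (hπμsum : ∑ i, πμ i = 1)
    (hstat : ∀ j, ∑ i, πμ i * P i j = πμ j)
    (π : χ → ℝ) (hπnn : ∀ i, 0 ≤ π i) (hπsum : ∑ i, π i = 1)
    (μ ν : Measure (ℕ → χ)) [IsProbabilityMeasure μ] [IsProbabilityMeasure ν]
    (hμ : IsMarkovMeasure μ πμ P) (hν : IsMarkovMeasure ν π P)
    (h : ℝ)
    (hH2 : Filter.Tendsto (fun k : ℕ => (1 / (k : ℝ)) * Real.log (renyiSum μ k))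
      Filter.atTop (nhds (-h))) :
    upperRenyi ν ≤ h := by
  obtain ⟨N, -, hN⟩ := hprim
  obtain ⟨c, hc, hle⟩ := hμ.exists_mul_renyiSum_le hPnn hProw hN hπμnn hπμsum hπsum hν
  have hlower : Tendsto (fun k : ℕ => (1 / ((k + N : ℕ) : ℝ)) *
      (Real.log c + Real.log (renyiSum μ k))) atTop (nhds (-h)) := by
    have h₁ : Tendsto (fun k : ℕ => 1 / ((k + N : ℕ) : ℝ)) atTop (nhds 0) :=
      (tendsto_add_atTop_iff_nat N).2 (tendsto_one_div_atTop_nhds_zero_nat (𝕜 := ℝ))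
    have h₂ : Tendsto (fun k : ℕ => (k : ℝ) / ((k : ℝ) + N)) atTop (nhds 1) :=
      tendsto_natCast_div_add_atTop (N : ℝ)
    have h₃ := (h₁.mul_const (Real.log c)).add (h₂.mul hH2)
    rw [zero_mul, one_mul, zero_add] at h₃
    refine h₃.congr' ?_
    filter_upwards [eventually_gt_atTop 0] with k hk
    have : (k : ℝ) ≠ 0 := by positivity
    push_cast
    field_simp
  have hge : ∀ᶠ k : ℕ in atTop,
      (1 / ((k + N : ℕ) : ℝ)) * (Real.log c + Real.log (renyiSum μ k)) ≤
        (1 / ((k + N : ℕ) : ℝ)) * Real.log (renyiSum ν (k + N)) := by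
    filter_upwards [eventually_gt_atTop 0] with k hk
    obtain ⟨n, rfl⟩ := Nat.exists_eq_add_of_le' hk
    have hμpos := (hμ.renyiSum_succ_mem_Ioc hPnn hProw hπμnn hπμsum n).1
    rw [← Real.log_mul hc.ne' hμpos.ne']
    exact mul_le_mul_of_nonneg_left (Real.log_le_log (mul_pos hc hμpos) (hle n)) (by positivity)
  have hupper : ∀ᶠ k : ℕ in atTop,
      (1 / ((k + N : ℕ) : ℝ)) * Real.log (renyiSum ν (k + N)) ≤ 0 := by
    filter_upwards [eventually_gt_atTop 0] with k hk
    obtain ⟨n, hn⟩ := Nat.exists_eq_add_of_le' (show 1 ≤ k + N by omega)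
    rw [hn]
    have hνmem := hν.renyiSum_succ_mem_Ioc hPnn hProw hπnn hπsum n
    exact mul_nonpos_of_nonneg_of_nonpos (by positivity)
      (Real.log_nonpos hνmem.1.le hνmem.2)
  rw [upperRenyi, neg_le, ← hlower.limsup_eq,
    ← limsup_nat_add (fun k : ℕ => (1 / (k : ℝ)) * Real.log (renyiSum ν k)) N]
  exact limsup_le_limsup hge hlower.isCoboundedUnder_le (isBoundedUnder_of_eventually_le hupper)
end

section
/- Let (X_n) be a Markov chain on the finite alphabet χ = {1,…,d} with transition matrix Q and initial distribution π₀, and let v : χ → ℕ^* be weights. Let f be the stretching encoder that maps a sequence x_0 x_1 x_2 … to the sequence obtained by replacing each symbol x_n by the block (x_n)_1 (x_n)_2 … (x_n)_{v(x_n)} of symbols of the alphabet χ̃ = {i_ℓ : i ∈ χ, 1 ≤ ℓ ≤ v(i)}. Then the encoded process (f(X)_n) is a Markov chain on χ̃: the pushforward f_*ℙ of the law ℙ of (X_n) is the Markov measure on χ̃^ℕ with transition matrix Q* given by Q*_{i_ℓ i_{ℓ+1}} = 1 for 1 ≤ ℓ ≤ v(i)−1, Q*_{i_{v(i)} j_1}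 = Q_{ij}, Q*_{ab} = 0 otherwise, and initial distribution π defined by π(i_1) = π₀(i) and π(i_j) = 0 for 1 < j ≤ v(i). -/
open MeasureTheory Filter

/-- The total length `∑_{j<m} v(x_j)` of the first `m` stretched blocks. -/
def blockSum {χ : Type*} (v : χ → ℕ) (x : ℕ → χ) (m : ℕ) : ℕ :=
  ∑ j ∈ Finset.range m, v (x j)

/-- The stretching encoder: `x₀ x₁ …` is sent to
`(x₀)₁ … (x₀)_{v x₀} (x₁)₁ … (x₁)_{v x₁} …`, where the symbol `i_ℓ` (with `1 ≤ ℓ ≤ v i`)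
of the stretched alphabet is encoded as the pair `(i, ℓ) : χ × ℕ`.  The `n`-th output
symbol lies in the `m`-th block, where `m` is the largest index with `blockSum v x m ≤ n`. -/
def stretch {χ : Type*} (v : χ → ℕ) (x : ℕ → χ) : ℕ → χ × ℕ := fun n =>
  let m := Nat.findGreatest (fun m => blockSum v x m ≤ n) n
  (x m, n - blockSum v x m + 1)

/-- The transition kernel `Q*` of the stretched chain on `χ × ℕ` (with `1`-indexed second
coordinate `ℓ ∈ {1, …, v i}`): `Q*_{i_ℓ i_{ℓ+1}} = 1` for `1 ≤ ℓ ≤ v i - 1`,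
`Q*_{i_{v i} j_1} = Q i j`, and `0` otherwise. -/
def QstarN {χ : Type*} [DecidableEq χ] (v : χ → ℕ) (Q : Matrix χ χ ℝ) :
    χ × ℕ → χ × ℕ → ℝ := fun a b =>
  if b.1 = a.1 ∧ b.2 = a.2 + 1 ∧ 1 ≤ a.2 ∧ a.2 ≤ v a.1 - 1 then 1
  else if a.2 = v a.1 ∧ b.2 = 1 then Q a.1 b.1 else 0

theorem blockSum_succ {χ : Type*} (v : χ → ℕ) (x : ℕ → χ) (m : ℕ) :
    blockSum v x (m + 1) = blockSum v x m + v (x m) :=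
  Finset.sum_range_succ _ _

theorem blockSum_mono {χ : Type*} (v : χ → ℕ) (x : ℕ → χ) : Monotone (blockSum v x) :=
  monotone_nat_of_le_succ fun m => by rw [blockSum_succ]; exact Nat.le_add_right _ _

theorem le_blockSum {χ : Type*} {v : χ → ℕ} (hv : ∀ i, 1 ≤ v i) (x : ℕ → χ) (m : ℕ) :
    m ≤ blockSum v x m := by
  induction m with
  | zero => exact Nat.zero_le _
  | succ m ih =>
    rw [blockSum_succ]
    exact Nat.add_le_add ih (hv _)

/-- The `ℓ`-th symbol of the `m`-th stretched block is `(x m, ℓ)`. -/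
theorem stretch_eq {χ : Type*} {v : χ → ℕ} (hv : ∀ i, 1 ≤ v i) (x : ℕ → χ) {n m l : ℕ}
    (hn : blockSum v x m + l = n + 1) (hl : 1 ≤ l) (hlv : l ≤ v (x m)) :
    stretch v x n = (x m, l) := by
  have hm : Nat.findGreatest (fun m => blockSum v x m ≤ n) n = m := by
    rw [Nat.findGreatest_eq_iff]
    refine ⟨(le_blockSum hv x m).trans (by omega), fun _ => by omega, fun k hk _ hkn => ?_⟩
    have h := blockSum_mono v x (Nat.succ_le_of_lt hk)
    rw [Nat.succ_eq_add_one, blockSum_succ] at h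
    omega
  simp only [stretch, hm]
  congr 1
  omega

theorem measurable_blockSum {χ : Type*} [MeasurableSpace χ] {v : χ → ℕ} (hv : Measurable v)
    (m : ℕ) : Measurable fun x : ℕ → χ => blockSum v x m :=
  Finset.measurable_sum _ fun j _ => hv.comp (measurable_pi_apply j)

theorem measurable_stretch {χ : Type*} [MeasurableSpace χ] {v : χ → ℕ} (hv : Measurable v) :
    Measurable (stretch v) := by
  refine measurable_pi_iff.2 fun n => ?_
  have hm : Measurable fun x : ℕ → χ =>
      Nat.findGreatest (fun m => blockSum v x m ≤ n) n :=
    measurable_findGreatest fun k _ => measurableSet_le (measurable_blockSum hv k) measurable_const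
  have hg : Measurable fun p : (ℕ → χ) × ℕ => (p.1 p.2, n - blockSum v p.1 p.2 + 1) :=
    measurable_from_prod_countable_left fun m =>
      (measurable_pi_apply m).prodMk
        ((measurable_const.sub (measurable_blockSum hv m)).add measurable_const)
  exact hg.comp (measurable_id.prodMk hm)

/-- A word of length `n + 1` in the stretched alphabet is either the common prefix of the images
of exactly the sequences in a cylinder, of the same weight, or it has weight zero and is not a
prefix of any image. -/
theorem stretch_prefix_iff_or_not {χ : Type*} [DecidableEq χ] (Q : Matrix χ χ ℝ) (π₀ : χ → ℝ)
    {v : χ → ℕ} (hv : ∀ i, 1 ≤ v i) (w : ℕ → χ × ℕ) (n : ℕ) :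
    (∃ (k : ℕ) (u : ℕ → χ),
      (∀ x, (∀ i ≤ n, stretch v x i = w i) ↔ ∀ i ≤ k, x i = u i) ∧
      (∀ x, (∀ i ≤ k, x i = u i) → blockSum v x k + (w n).2 = n + 1) ∧
      (w n).1 = u k ∧ 1 ≤ (w n).2 ∧ (w n).2 ≤ v (u k) ∧
      (if (w 0).2 = 1 then π₀ (w 0).1 else 0)
          * ∏ i ∈ Finset.range n, QstarN v Q (w i) (w (i + 1))
        = π₀ (u 0) * ∏ i ∈ Finset.range k, Q (u i) (u (i + 1))) ∨
    ((∀ x, ¬ ∀ i ≤ n, stretch v x i = w i) ∧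
      (if (w 0).2 = 1 then π₀ (w 0).1 else 0)
          * ∏ i ∈ Finset.range n, QstarN v Q (w i) (w (i + 1)) = 0) := by
  have hsucc : ∀ (n : ℕ) (p : ℕ → Prop), (∀ i ≤ n + 1, p i) ↔ (∀ i ≤ n, p i) ∧ p (n + 1) :=
    fun n p => ⟨fun h => ⟨fun i hi => h i (by omega), h _ le_rfl⟩, fun h i hi =>
      (Nat.le_succ_iff.1 hi).elim (h.1 i) fun e => e ▸ h.2⟩
  induction n with
  | zero =>
    have h0 : ∀ x : ℕ → χ, stretch v x 0 = (x 0, 1) := fun x =>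
      stretch_eq hv x (by simp [blockSum]) le_rfl (hv _)
    by_cases h1 : (w 0).2 = 1
    · refine Or.inl ⟨0, fun _ => (w 0).1, ?_, ?_, rfl, h1.ge, h1.le.trans (hv _), by simp [h1]⟩
      · simp [h0, Prod.ext_iff, h1]
      · simp [blockSum, h1]
    · refine Or.inr ⟨fun x h => h1 ?_, by simp [h1]⟩
      rw [← h 0 le_rfl, h0]
  | succ n ih =>
    simp only [Finset.prod_range_succ, ← mul_assoc, hsucc n]
    rcases ih with ⟨k, u, hiff, hsum, hwu, hl, hlv, hprod⟩ | ⟨hne, h0⟩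
    · rw [hprod]
      rcases hlv.eq_or_lt with heq | hlt
      · have hst : ∀ x : ℕ → χ, (∀ i ≤ k, x i = u i) →
            blockSum v x (k + 1) + 1 = n + 2 ∧ stretch v x (n + 1) = (x (k + 1), 1) := by
          intro x hx
          have hb : blockSum v x (k + 1) + 1 = n + 2 := by
            have := hsum x hx
            rw [blockSum_succ, hx k le_rfl]
            omega
          exact ⟨hb, stretch_eq hv x hb le_rfl (hv _)⟩
        by_cases h1 : (w (n + 1)).2 = 1
        · left
          have hu : ∀ i ≤ k, Function.update u (k + 1) (w (n + 1)).1 i = u i := fun i hi =>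
            Function.update_of_ne (by omega) _ _
          have hcyl : ∀ x : ℕ → χ,
              (∀ i ≤ k + 1, x i = Function.update u (k + 1) (w (n + 1)).1 i) ↔
                (∀ i ≤ k, x i = u i) ∧ x (k + 1) = (w (n + 1)).1 := by
            intro x
            rw [hsucc k, Function.update_self]
            exact and_congr_left' (forall₂_congr fun i hi => by rw [hu i hi])
          refine ⟨k + 1, Function.update u (k + 1) (w (n + 1)).1, fun x => ?_, fun x hx => ?_,
            by rw [Function.update_self], h1.ge, h1.le.trans (hv _), ?_⟩
          · rw [hcyl, hiff]
            refine and_congr_right fun hx => ?_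
            rw [(hst x hx).2, Prod.ext_iff, h1]
            simp
          · rw [h1]
            exact (hst x ((hcyl x).1 hx).1).1
          · have hQ : QstarN v Q (w n) (w (n + 1)) = Q (u k) (w (n + 1)).1 := by
              have := hv (u k)
              rw [QstarN, hwu, if_neg (by omega), if_pos ⟨heq, h1⟩]
            rw [Finset.prod_range_succ, hu 0 (Nat.zero_le _), hu k le_rfl, Function.update_self,
              hQ, ← mul_assoc]
            congr 2
            refine Finset.prod_congr rfl fun i hi => ?_
            rw [Finset.mem_range] at hi
            rw [hu i hi.le, hu (i + 1) hi]
        · refine Or.inr ⟨fun x hx => h1 ?_, ?_⟩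
          · rw [← hx.2, (hst x ((hiff x).1 hx.1)).2]
          · have := hv (u k)
            rw [QstarN, hwu, if_neg (by omega), if_neg (by omega), mul_zero]
      · have hst : ∀ x : ℕ → χ, (∀ i ≤ k, x i = u i) →
            blockSum v x k + ((w n).2 + 1) = n + 2 ∧
              stretch v x (n + 1) = (u k, (w n).2 + 1) := by
          intro x hx
          have hb : blockSum v x k + ((w n).2 + 1) = n + 2 := by
            have := hsum x hx
            omega
          refine ⟨hb, ?_⟩
          rw [stretch_eq hv x hb (by omega) (by rw [hx k le_rfl]; omega), hx k le_rfl]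
        by_cases h1 : w (n + 1) = (u k, (w n).2 + 1)
        · refine Or.inl ⟨k, u, fun x => ?_, fun x hx => ?_, by rw [h1], by simp [h1],
            by rw [h1]; exact hlt, ?_⟩
          · rw [hiff, h1]
            exact and_iff_left_of_imp fun hx => (hst x hx).2
          · rw [h1]
            exact (hst x hx).1
          · rw [QstarN, h1, hwu, if_pos ⟨rfl, rfl, hl, by omega⟩, mul_one]
        · refine Or.inr ⟨fun x hx => h1 ?_, ?_⟩
          · rw [← hx.2, (hst x ((hiff x).1 hx.1)).2]
          · rw [QstarN, hwu, if_neg fun h => h1 (Prod.ext h.1 h.2.1), if_neg (by omega), mul_zero]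
    · exact Or.inr ⟨fun x hx => hne x hx.1, by rw [h0, zero_mul]⟩

/-- the pushforward of the Markov measure `ℙ` (initial distribution `π₀`,
transition matrix `Q`) by the stretching encoder is the Markov measure on `(χ × ℕ)^ℕ` with
transition kernel `Q*` and initial distribution `π(i,1) = π₀ i`, `π(i,ℓ) = 0` for `ℓ ≠ 1`. -/
theorem stretch_pushforward_is_markov
    {d : ℕ} (hd : 0 < d)
    (Q : Matrix (Fin d) (Fin d) ℝ) (hQnn : ∀ i j, 0 ≤ Q i j) (hQrow : ∀ i, ∑ j, Q i j = 1)
    (π₀ : Fin d → ℝ) (hπ₀nn : ∀ i, 0 ≤ π₀ i) (hπ₀sum : ∑ i, π₀ i = 1)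
    (P : Measure (ℕ → Fin d)) [IsProbabilityMeasure P] (hP : IsMarkovMeasure P π₀ Q)
    (v : Fin d → ℕ) (hv : ∀ i, 1 ≤ v i) :
    ∀ (n : ℕ) (w : ℕ → Fin d × ℕ),
      ((P.map (stretch v)) {z | ∀ i ≤ n, z i = w i}).toReal
        = (if (w 0).2 = 1 then π₀ (w 0).1 else 0)
            * ∏ i ∈ Finset.range n, QstarN v Q (w i) (w (i + 1)) := by
  intro n w
  have hset : MeasurableSet {z : ℕ → Fin d × ℕ | ∀ i ≤ n, z i = w i} := by
    simp only [Set.ofPred_forall]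
    exact .iInter fun i => .iInter fun _ =>
      measurableSet_eq_fun (measurable_pi_apply i) measurable_const
  rw [Measure.map_apply (measurable_stretch (measurable_of_finite v)) hset, Set.preimage_ofPred_eq]
  rcases stretch_prefix_iff_or_not Q π₀ hv w n with ⟨k, u, hiff, -, -, -, -, hprod⟩ | ⟨hne, h0⟩
  · simp only [hiff]
    rw [hprod, hP k u]
  · rw [h0, Set.eq_empty_of_forall_notMem (s := {x | ∀ i ≤ n, stretch v x i = w i}) hne]
    simp
end

section
/- Let (X, A, T, μ) be a dynamical system, i.e. (X,d) a metric space, T : X → X measurable preserving the Borel probability measure μ, and let f : X → Y ⊂ ℝ^N be a measurable observation such that the lower correlation dimension of the pushforward measure satisfies C̲_{f_*μ} > 0. Then for μ ⊗ μ-almost every (x,y) ∈ X × X, limsup_{n→∞} (log m_n^f(x,y))/(−log n) ≤ 2/C̲_{f_*μ}. -/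
open MeasureTheory Filter

/-- The shortest distance between the observed orbits of `x` and `y` up to time `n`:
`m_n^f(x,y) = min_{0 ≤ i,j ≤ n-1} d(f(Tⁱx), f(Tʲy))`. -/
noncomputable def mObs {X E : Type*} [PseudoMetricSpace E]
    (T : X → X) (f : X → E) (n : ℕ) (x y : X) : ℝ :=
  sInf {d : ℝ | ∃ i j : ℕ, i < n ∧ j < n ∧ d = dist (f (T^[i] x)) (f (T^[j] y))}

/-- The correlation integral `∫ ν(B(x,r)) dν(x)`. -/
noncomputable def corrIntegral {E : Type*} [PseudoMetricSpace E] [MeasurableSpace E]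
    (ν : Measure E) (r : ℝ) : ℝ :=
  ∫ x, (ν (Metric.ball x r)).toReal ∂ν

/-- The lower correlation dimension `C̲_ν = liminf_{r→0⁺} log ∫ ν(B(x,r)) dν / log r`. -/
noncomputable def lowerCorrDim {E : Type*} [PseudoMetricSpace E] [MeasurableSpace E]
    (ν : Measure E) : ℝ :=
  Filter.liminf (fun r : ℝ => Real.log (corrIntegral ν r) / Real.log r)
    (nhdsWithin 0 (Set.Ioi 0))

/-- The upper correlation dimension `C̄_ν = limsup_{r→0⁺} log ∫ ν(B(x,r)) dν / log r`. -/
noncomputable def upperCorrDim {E : Type*} [PseudoMetricSpace E] [MeasurableSpace E]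
    (ν : Measure E) : ℝ :=
  Filter.limsup (fun r : ℝ => Real.log (corrIntegral ν r) / Real.log r)
    (nhdsWithin 0 (Set.Ioi 0))

/-- The correlation integral is the product measure of the `r`-neighbourhood of the diagonal. -/
theorem prod_setOf_dist_lt_eq_ofReal_corrIntegral {E : Type*} [PseudoMetricSpace E]
    [MeasurableSpace E] [OpensMeasurableSpace E] [SecondCountableTopology E]
    (ν : Measure E) [IsProbabilityMeasure ν] (r : ℝ) :
    (ν.prod ν) {p : E × E | dist p.1 p.2 < r} = ENNReal.ofReal (corrIntegral ν r) := by
  have hs : MeasurableSet {p : E × E | dist p.1 p.2 < r} :=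
    measurableSet_lt (measurable_fst.dist measurable_snd) measurable_const
  have hball (x : E) :
      ν (Metric.ball x r) = ν (Prod.mk x ⁻¹' {p : E × E | dist p.1 p.2 < r}) := by
    congr 1
    ext y
    simp [dist_comm]
  have hfin : ∫⁻ x, ν (Metric.ball x r) ∂ν ≠ ⊤ := by
    simp_rw [hball]
    rw [← Measure.prod_apply hs]
    exact measure_ne_top _ _
  have hmeas : Measurable fun x => ν (Metric.ball x r) := by
    simp_rw [hball]
    exact measurable_measure_prodMk_left hs
  rw [corrIntegral, integral_toReal hmeas.aemeasurable
    (Eventually.of_forall fun x => measure_lt_top _ _), ENNReal.ofReal_toReal hfin,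
    Measure.prod_apply hs]
  simp_rw [hball]

/-- A power below the lower correlation dimension bounds the correlation integral. -/
theorem eventually_corrIntegral_le_rpow {E : Type*} [PseudoMetricSpace E] [MeasurableSpace E]
    (ν : Measure E) {c : ℝ} (hc : 0 < c) (hcC : c < lowerCorrDim ν) :
    ∀ᶠ r in nhdsWithin (0 : ℝ) (Set.Ioi 0), corrIntegral ν r ≤ r ^ c := by
  rw [lowerCorrDim, liminf_eq] at hcC
  have hne : {b | ∀ᶠ r in nhdsWithin (0 : ℝ) (Set.Ioi 0),
      b ≤ Real.log (corrIntegral ν r) / Real.log r}.Nonempty := by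
    by_contra hempty
    rw [Set.not_nonempty_iff_eq_empty] at hempty
    rw [hempty, Real.sSup_empty] at hcC
    linarith
  obtain ⟨b, hb, hcb⟩ := exists_lt_of_lt_csSup hne hcC
  rw [Set.mem_ofPred_eq] at hb
  filter_upwards [hb, Ioo_mem_nhdsGT (zero_lt_one' ℝ)] with r hr hr01
  have hlog : Real.log r < 0 := Real.log_neg hr01.1 hr01.2
  have hI : 0 ≤ corrIntegral ν r := integral_nonneg fun _ => ENNReal.toReal_nonneg
  rcases hI.eq_or_lt with h0 | hpos
  · rw [← h0]
    exact Real.rpow_nonneg hr01.1.le c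
  · rw [Real.le_rpow_iff_log_le hpos hr01.1]
    exact (le_div_iff_of_neg hlog).1 (hcb.le.trans hr)

/-- The probability that two observed orbit segments of length `n` come `r`-close is at most
`n²` times the correlation integral. -/
theorem prod_setOf_exists_dist_iterate_lt_le {X E : Type*} [MeasurableSpace X]
    [PseudoMetricSpace E] [MeasurableSpace E] [OpensMeasurableSpace E]
    [SecondCountableTopology E] {T : X → X} {μ : Measure X} [IsProbabilityMeasure μ]
    (hT : MeasurePreserving T μ μ) {f : X → E} (hf : Measurable f) (n : ℕ) (r : ℝ) :
    (μ.prod μ) {q : X × X | ∃ i < n, ∃ j < n, dist (f (T^[i] q.1)) (f (T^[j] q.2)) < r} ≤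
      n * (n * ENNReal.ofReal (corrIntegral (μ.map f) r)) := by
  have : IsProbabilityMeasure (μ.map f) := Measure.isProbabilityMeasure_map hf.aemeasurable
  have hs : MeasurableSet {p : E × E | dist p.1 p.2 < r} :=
    measurableSet_lt (measurable_fst.dist measurable_snd) measurable_const
  have hiter (i : ℕ) : MeasurePreserving (fun x => f (T^[i] x)) μ (μ.map f) :=
    (hf.measurePreserving μ).comp (hT.iterate i)
  have hpair (i j : ℕ) :
      (μ.prod μ) {q : X × X | dist (f (T^[i] q.1)) (f (T^[j] q.2)) < r} =
        ENNReal.ofReal (corrIntegral (μ.map f) r) := by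
    rw [← prod_setOf_dist_lt_eq_ofReal_corrIntegral,
      ← ((hiter i).prod (hiter j)).measure_preimage hs.nullMeasurableSet]
    rfl
  have hunion :
      {q : X × X | ∃ i < n, ∃ j < n, dist (f (T^[i] q.1)) (f (T^[j] q.2)) < r} =
        ⋃ i ∈ Finset.range n, ⋃ j ∈ Finset.range n,
          {q : X × X | dist (f (T^[i] q.1)) (f (T^[j] q.2)) < r} := by
    ext q
    simp
  rw [hunion]
  calc
    _ ≤ ∑ i ∈ Finset.range n, ∑ j ∈ Finset.range n,
        (μ.prod μ) {q : X × X | dist (f (T^[i] q.1)) (f (T^[j] q.2)) < r} :=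
      (measure_biUnion_finset_le _ _).trans
        (Finset.sum_le_sum fun i _ => measure_biUnion_finset_le _ _)
    _ = n * (n * ENNReal.ofReal (corrIntegral (μ.map f) r)) := by
      simp [hpair]

/-- Above the critical exponent, the shortest distance eventually dominates `n ^ (-a)`. -/
theorem ae_eventually_rpow_neg_le_mObs {X E : Type*} [MeasurableSpace X]
    [PseudoMetricSpace E] [MeasurableSpace E] [OpensMeasurableSpace E]
    [SecondCountableTopology E] {T : X → X} {μ : Measure X} [IsProbabilityMeasure μ]
    (hT : MeasurePreserving T μ μ) {f : X → E} (hf : Measurable f)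
    (hC : 0 < lowerCorrDim (μ.map f)) {a : ℝ} (ha : 2 / lowerCorrDim (μ.map f) < a) :
    ∀ᵐ q ∂(μ.prod μ), ∀ᶠ n : ℕ in atTop, (n : ℝ) ^ (-a) ≤ mObs T f n q.1 q.2 := by
  have ha0 : 0 < a := (by positivity : 0 < 2 / lowerCorrDim (μ.map f)).trans ha
  obtain ⟨c, hac, hcC⟩ := exists_between ((div_lt_comm₀ hC ha0).1 ha)
  have hc : 0 < c := (by positivity : 0 < 2 / a).trans hac
  have hexp : 2 < c * a := (div_lt_iff₀ ha0).1 hac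
  have hbase : (0 : ℝ) < 2 ^ (-a) := by positivity
  have hbase1 : (2 : ℝ) ^ (-a) < 1 :=
    Real.rpow_lt_one_of_one_lt_of_neg one_lt_two (neg_lt_zero.2 ha0)
  have hr : Tendsto (fun k : ℕ => ((2 : ℝ) ^ (-a)) ^ k) atTop (nhdsWithin 0 (Set.Ioi 0)) :=
    tendsto_nhdsWithin_iff.2 ⟨tendsto_pow_atTop_nhds_zero_of_lt_one hbase.le hbase1,
      Eventually.of_forall fun k => pow_pos hbase k⟩
  set A : ℕ → Set (X × X) := fun k =>
    {q | ∃ i < 2 ^ (k + 1), ∃ j < 2 ^ (k + 1),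
      dist (f (T^[i] q.1)) (f (T^[j] q.2)) < ((2 : ℝ) ^ (-a)) ^ k} with hA
  have hAle : ∀ᶠ k in atTop,
      (μ.prod μ) (A k) ≤ ENNReal.ofReal (4 * ((2 : ℝ) ^ (2 - c * a)) ^ k) := by
    filter_upwards [hr.eventually (eventually_corrIntegral_le_rpow (μ.map f) hc hcC)] with k hk
    refine (prod_setOf_exists_dist_iterate_lt_le hT hf _ _).trans ?_
    rw [← ENNReal.ofReal_natCast, ← ENNReal.ofReal_mul (Nat.cast_nonneg _),
      ← ENNReal.ofReal_mul (Nat.cast_nonneg _)]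
    refine ENNReal.ofReal_le_ofReal ?_
    have hpow : (((2 : ℝ) ^ (-a)) ^ k) ^ c = ((2 : ℝ) ^ (-(c * a))) ^ k := by
      rw [← Real.rpow_natCast, ← Real.rpow_natCast, ← Real.rpow_mul hbase.le,
        ← Real.rpow_mul zero_le_two, ← Real.rpow_mul zero_le_two]
      ring_nf
    have hsplit : (2 : ℝ) ^ (2 - c * a) = 4 * 2 ^ (-(c * a)) := by
      rw [sub_eq_add_neg, Real.rpow_add two_pos]
      norm_num
    rw [hsplit, mul_pow, ← hpow]
    have hfour : (4 : ℝ) ^ k = 2 ^ k * 2 ^ k := by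
      rw [← mul_pow]
      norm_num
    calc
      _ ≤ ((2 ^ (k + 1) : ℕ) : ℝ) * ((2 ^ (k + 1) : ℕ) * (((2 : ℝ) ^ (-a)) ^ k) ^ c) := by
        gcongr
      _ = 4 * (4 ^ k * (((2 : ℝ) ^ (-a)) ^ k) ^ c) := by
        rw [hfour]
        push_cast
        ring
  have hq1 : (2 : ℝ) ^ (2 - c * a) < 1 :=
    Real.rpow_lt_one_of_one_lt_of_neg one_lt_two (by linarith)
  have hsum : Summable fun k : ℕ => 4 * ((2 : ℝ) ^ (2 - c * a)) ^ k :=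
    (summable_geometric_of_lt_one (by positivity) hq1).mul_left 4
  have hAreal : Summable fun k => (μ.prod μ).real (A k) := by
    refine hsum.of_norm_bounded_eventually_nat ?_
    filter_upwards [hAle] with k hk
    rw [Real.norm_of_nonneg measureReal_nonneg]
    exact ENNReal.toReal_le_of_le_ofReal (by positivity) hk
  have hAsum : ∑' k, (μ.prod μ) (A k) ≠ ⊤ := by
    simpa [ofReal_measureReal] using hAreal.tsum_ofReal_ne_top
  filter_upwards [ae_eventually_notMem hAsum] with q hq
  have hlog : Tendsto (Nat.log 2) atTop atTop :=
    Nat.log_monotone.tendsto_atTop_atTop fun k => ⟨2 ^ k, (Nat.log_pow one_lt_two k).ge⟩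
  filter_upwards [hlog.eventually hq, eventually_gt_atTop 0] with n hn hn0
  simp only [hA, Set.mem_ofPred_eq, not_exists, not_and, not_lt] at hn
  have hle : (n : ℝ) ^ (-a) ≤ ((2 : ℝ) ^ (-a)) ^ Nat.log 2 n := by
    rw [Real.rpow_pow_comm zero_le_two]
    refine Real.rpow_le_rpow_of_nonpos (by positivity) ?_ (neg_nonpos.2 ha0.le)
    exact_mod_cast Nat.pow_log_le_self 2 hn0.ne'
  have hlt : n < 2 ^ (Nat.log 2 n + 1) := Nat.lt_pow_succ_log_self one_lt_two n
  refine le_csInf ⟨_, 0, 0, hn0, hn0, rfl⟩ ?_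
  rintro d ⟨i, j, hi, hj, rfl⟩
  exact hle.trans (hn i (hi.trans hlt) j (hj.trans hlt))

/-- A nonnegative eventual upper bound is an upper bound of the real `limsup`, with no boundedness
assumption from below. -/
theorem Real.limsup_le_of_eventually_le {ι : Type*} {l : Filter ι} {u : ι → ℝ} {a : ℝ}
    (ha : 0 ≤ a) (h : ∀ᶠ i in l, u i ≤ a) : limsup u l ≤ a := by
  rw [limsup_eq]
  by_cases hb : BddBelow {b | ∀ᶠ i in l, u i ≤ b}
  · exact csInf_le hb h
  · rwa [Real.sInf_of_not_bddBelow hb]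

/-- if the lower correlation dimension of the pushforward measure is positive,
then `limsup (log mₙᶠ)/(-log n) ≤ 2 / C̲_{f_*μ}` for `μ ⊗ μ`-almost every pair. -/
theorem shortest_distance_observed_orbits_upper
    {X : Type*} [MeasurableSpace X] {N : ℕ}
    (T : X → X) (μ : Measure X) [IsProbabilityMeasure μ] (hT : MeasurePreserving T μ μ)
    (f : X → EuclideanSpace ℝ (Fin N)) (hf : Measurable f)
    (hC : 0 < lowerCorrDim (μ.map f)) :
    ∀ᵐ q ∂(μ.prod μ),
      Filter.limsup (fun n : ℕ => Real.log (mObs T f n q.1 q.2) / (-Real.log (n : ℝ)))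
        Filter.atTop ≤ 2 / lowerCorrDim (μ.map f) := by
  have hae (m : ℕ) := ae_eventually_rpow_neg_le_mObs hT hf hC
    (lt_add_of_pos_right (2 / lowerCorrDim (μ.map f)) (Nat.one_div_pos_of_nat (n := m)))
  filter_upwards [ae_all_iff.2 hae] with q hq
  refine le_of_forall_pos_le_add fun ε hε => ?_
  obtain ⟨m, hm⟩ := exists_nat_one_div_lt hε
  have hbound : 0 ≤ 2 / lowerCorrDim (μ.map f) + 1 / ((m : ℝ) + 1) := by positivity
  refine (Real.limsup_le_of_eventually_le hbound ?_).trans (by linarith)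
  filter_upwards [hq m, eventually_gt_atTop 1] with n hn hn1
  have hn1' : (1 : ℝ) < n := by exact_mod_cast hn1
  have hlog := Real.log_le_log (by positivity) hn
  rw [Real.log_rpow (by positivity)] at hlog
  rw [div_le_iff_of_neg (neg_lt_zero.2 (Real.log_pos hn1'))]
  linarith
end

section
/- Let T = (T_ω)_{ω∈Ω} be a random dynamical system on X ⊂ ℝ^N over (Ω, B(Ω), ℙ, θ) with an invariant measure μ whose marginal ν on X satisfies C̲_ν > 0. Then for μ ⊗ μ-almost every (ω, x, ω̃, x̃) ∈ (Ω × X) × (Ω × X), limsup_{n→∞} (log m_n^{ω,ω̃}(x,x̃))/(−log n) ≤ 2/C̲_ν. -/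
open MeasureTheory Filter

/-- The shortest distance between two random orbits, expressed through the skew product `S`:
`m_n^{ω,ω̃}(x,x̃) = min_{0 ≤ i,j ≤ n-1} d((Sⁱ(ω,x))₂, (Sʲ(ω̃,x̃))₂)`. -/
noncomputable def mRand {Ω X : Type*} [PseudoMetricSpace X]
    (S : Ω × X → Ω × X) (n : ℕ) (p q : Ω × X) : ℝ :=
  sInf {d : ℝ | ∃ i j : ℕ, i < n ∧ j < n ∧ d = dist (S^[i] p).2 (S^[j] q).2}

section correlation

variable {Z E : Type*} [MeasurableSpace Z] [PseudoMetricSpace E] [MeasurableSpace E]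

theorem corrIntegral_eq_prod [OpensMeasurableSpace E] [SecondCountableTopology E]
    (ν : Measure E) [IsProbabilityMeasure ν] (r : ℝ) :
    ENNReal.ofReal (corrIntegral ν r) = ν.prod ν {p : E × E | dist p.1 p.2 < r} := by
  have hmeas : MeasurableSet {p : E × E | dist p.1 p.2 < r} :=
    measurableSet_lt (measurable_fst.dist measurable_snd) measurable_const
  have hslice (x : E) : Prod.mk x ⁻¹' {p : E × E | dist p.1 p.2 < r} = Metric.ball x r := by
    ext y
    simp [dist_comm]
  have hball : Measurable fun x => ν (Metric.ball x r) := by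
    simpa only [hslice] using measurable_measure_prodMk_left (ν := ν) hmeas
  rw [Measure.prod_apply hmeas]
  simp only [hslice]
  rw [corrIntegral, integral_toReal hball.aemeasurable (ae_of_all _ fun x => measure_lt_top _ _),
    ENNReal.ofReal_toReal]
  exact ((lintegral_mono fun x => prob_le_one).trans_lt (by simp)).ne

theorem measure_dist_orbits_lt [OpensMeasurableSpace E] [SecondCountableTopology E]
    {μ : Measure Z} [IsProbabilityMeasure μ] {S : Z → Z} (hS : MeasurePreserving S μ μ)
    {f : Z → E} (hf : Measurable f) (i j : ℕ) (r : ℝ) :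
    μ.prod μ {q : Z × Z | dist (f (S^[i] q.1)) (f (S^[j] q.2)) < r} =
      ENNReal.ofReal (corrIntegral (μ.map f) r) := by
  have := Measure.isProbabilityMeasure_map (μ := μ) hf.aemeasurable
  have hmp (k : ℕ) : MeasurePreserving (fun z => f (S^[k] z)) μ (μ.map f) :=
    (hf.measurePreserving μ).comp (hS.iterate k)
  rw [corrIntegral_eq_prod, ← ((hmp i).prod (hmp j)).measure_preimage
    (measurableSet_lt (measurable_fst.dist measurable_snd) measurable_const).nullMeasurableSet]
  rfl

/-- A positive lower correlation dimension bounds the correlation integral by powers of `r`. -/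
theorem exists_corrIntegral_le_rpow {ν : Measure E} {b : ℝ} (hb : 0 < b)
    (h : b < lowerCorrDim ν) :
    ∃ a > b, ∀ᶠ r in nhdsWithin (0 : ℝ) (Set.Ioi 0), corrIntegral ν r ≤ r ^ a := by
  have hne : {a | ∀ᶠ r in nhdsWithin (0 : ℝ) (Set.Ioi 0),
      a ≤ Real.log (corrIntegral ν r) / Real.log r}.Nonempty := by
    by_contra hempty
    rw [Set.not_nonempty_iff_eq_empty] at hempty
    rw [lowerCorrDim, liminf_eq, hempty, Real.sSup_empty] at h
    exact hb.not_gt h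
  rw [lowerCorrDim, liminf_eq] at h
  obtain ⟨a, ha, hba⟩ := exists_lt_of_lt_csSup hne h
  refine ⟨a, hba, ?_⟩
  filter_upwards [ha, Ioo_mem_nhdsGT one_pos] with r hr hr01
  have hlog : Real.log r < 0 := Real.log_neg hr01.1 hr01.2
  rw [le_div_iff_of_neg hlog] at hr
  have hnonneg : 0 ≤ corrIntegral ν r := integral_nonneg fun _ => ENNReal.toReal_nonneg
  rcases hnonneg.eq_or_lt with h0 | hpos
  · rw [← h0]
    exact Real.rpow_nonneg hr01.1.le a
  · rwa [Real.le_rpow_iff_log_le hpos hr01.1]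

/-- Along dyadic times, almost every pair of orbits is eventually `2 ^ (-s k)`-separated. -/
theorem ae_eventually_dyadic_le_dist [OpensMeasurableSpace E] [SecondCountableTopology E]
    {μ : Measure Z} [IsProbabilityMeasure μ] {S : Z → Z} (hS : MeasurePreserving S μ μ)
    {f : Z → E} (hf : Measurable f) {s : ℝ} (hs : 0 < s) (h : 2 / s < lowerCorrDim (μ.map f)) :
    ∀ᵐ q ∂(μ.prod μ), ∀ᶠ k : ℕ in atTop, ∀ i < 2 ^ (k + 1), ∀ j < 2 ^ (k + 1),
      ((2 : ℝ) ^ k) ^ (-s) ≤ dist (f (S^[i] q.1)) (f (S^[j] q.2)) := by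
  obtain ⟨a, ha, hcorr⟩ := exists_corrIntegral_le_rpow (by positivity) h
  set A : ℕ → Set (Z × Z) := fun k =>
    ⋃ ij ∈ Finset.range (2 ^ (k + 1)) ×ˢ Finset.range (2 ^ (k + 1)),
    {q : Z × Z | dist (f (S^[ij.1] q.1)) (f (S^[ij.2] q.2)) < ((2 : ℝ) ^ k) ^ (-s)} with hA
  have hA_le (k : ℕ) : μ.prod μ (A k) ≤
      ENNReal.ofReal (4 ^ (k + 1) * corrIntegral (μ.map f) (((2 : ℝ) ^ k) ^ (-s))) := by
    refine (measure_biUnion_finset_le _ _).trans ?_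
    simp only [measure_dist_orbits_lt hS hf, Finset.sum_const, Finset.card_product,
      Finset.card_range, nsmul_eq_mul]
    rw [ENNReal.ofReal_mul (by positivity), ← mul_pow]
    refine le_of_eq ?_
    congr 1
    norm_num [ENNReal.ofReal_pow]
  have hr : Tendsto (fun k : ℕ => ((2 : ℝ) ^ k) ^ (-s)) atTop (nhdsWithin 0 (Set.Ioi 0)) :=
    tendsto_nhdsWithin_iff.2
      ⟨(tendsto_rpow_neg_atTop hs).comp (tendsto_pow_atTop_atTop_of_one_lt one_lt_two),
        Eventually.of_forall fun k => Set.mem_Ioi.2 (by positivity)⟩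
  have hsa : 2 < s * a := by
    rw [gt_iff_lt, div_lt_iff₀ hs] at ha
    linarith
  set ρ : ℝ := 4 * (2 : ℝ) ^ (-(s * a)) with hρ
  have hρ0 : 0 ≤ ρ := by positivity
  have hρ1 : ρ < 1 := by
    have h4 : (2 : ℝ) ^ (-(s * a)) < (2 : ℝ) ^ (-2 : ℝ) :=
      Real.rpow_lt_rpow_of_exponent_lt one_lt_two (by linarith)
    have h5 : (2 : ℝ) ^ (-2 : ℝ) = 1 / 4 := by
      rw [Real.rpow_neg two_pos.le]
      norm_num
    rw [h5] at h4
    linarith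
  have hgeom (k : ℕ) : (4 : ℝ) ^ (k + 1) * (((2 : ℝ) ^ k) ^ (-s)) ^ a = 4 * ρ ^ k := by
    rw [← Real.rpow_mul (by positivity), ← Real.rpow_natCast_mul two_pos.le, mul_comm (k : ℝ),
      Real.rpow_mul_natCast two_pos.le, hρ, mul_pow, neg_mul]
    ring
  have hsum : ∃ k₀, ∑' k, μ.prod μ (A (k + k₀)) ≠ ⊤ := by
    obtain ⟨k₀, hk₀⟩ := eventually_atTop.1 (hr.eventually hcorr)
    refine ⟨k₀, ?_⟩
    have hs' : Summable fun k => 4 * ρ ^ (k + k₀) :=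
      (summable_nat_add_iff k₀).2 ((summable_geometric_of_lt_one hρ0 hρ1).mul_left 4)
    refine ne_top_of_le_ne_top hs'.tsum_ofReal_ne_top (ENNReal.tsum_le_tsum fun k => ?_)
    refine (hA_le _).trans (ENNReal.ofReal_le_ofReal ?_)
    rw [← hgeom]
    gcongr
    exact hk₀ _ (Nat.le_add_left _ _)
  obtain ⟨k₀, hk₀⟩ := hsum
  filter_upwards [ae_eventually_notMem hk₀] with q hq
  rw [eventually_atTop] at hq ⊢
  obtain ⟨K, hK⟩ := hq
  refine ⟨K + k₀, fun k hk i hi j hj => ?_⟩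
  have hnot := hK (k - k₀) (by omega)
  rw [Nat.sub_add_cancel (by omega)] at hnot
  contrapose! hnot
  simp only [hA, Set.mem_iUnion]
  exact ⟨(i, j), by simp [hi, hj], hnot⟩

end correlation

theorem rpow_neg_le_mRand {Ω X : Type*} [PseudoMetricSpace X] {S : Ω × X → Ω × X} {s : ℝ}
    (hs : 0 ≤ s) {p q : Ω × X} {n : ℕ} (hn : n ≠ 0)
    (h : ∀ i < 2 ^ (Nat.log 2 n + 1), ∀ j < 2 ^ (Nat.log 2 n + 1),
      ((2 : ℝ) ^ Nat.log 2 n) ^ (-s) ≤ dist (S^[i] p).2 (S^[j] q).2) :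
    (n : ℝ) ^ (-s) ≤ mRand S n p q := by
  have hlt : n < 2 ^ (Nat.log 2 n + 1) := Nat.lt_pow_succ_log_self one_lt_two n
  refine le_csInf ⟨_, 0, 0, by omega, by omega, rfl⟩ ?_
  rintro _ ⟨i, j, hi, hj, rfl⟩
  refine le_trans ?_ (h i (hi.trans hlt) j (hj.trans hlt))
  refine Real.rpow_le_rpow_of_nonpos (by positivity) ?_ (by linarith)
  exact_mod_cast Nat.pow_log_le_self 2 hn

theorem limsup_le_of_eventually_le_of_nonneg {u : ℕ → ℝ} {s : ℝ} (hs : 0 ≤ s)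
    (h : ∀ᶠ n in atTop, u n ≤ s) : limsup u atTop ≤ s := by
  rw [limsup_eq]
  by_cases hb : BddBelow {a | ∀ᶠ n in atTop, u n ≤ a}
  · exact csInf_le hb h
  · rwa [Real.sInf_of_not_bddBelow hb]

theorem limsup_log_mRand_le {Ω X : Type*} [PseudoMetricSpace X] {S : Ω × X → Ω × X} {s : ℝ}
    (hs : 0 ≤ s) {p q : Ω × X}
    (h : ∀ᶠ k : ℕ in atTop, ∀ i < 2 ^ (k + 1), ∀ j < 2 ^ (k + 1),
      ((2 : ℝ) ^ k) ^ (-s) ≤ dist (S^[i] p).2 (S^[j] q).2) :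
    limsup (fun n : ℕ => Real.log (mRand S n p q) / (-Real.log (n : ℝ))) atTop ≤ s := by
  have hlog : Tendsto (Nat.log 2) atTop atTop :=
    tendsto_atTop_atTop.2 fun b => ⟨2 ^ b, fun n hn => Nat.le_log_of_pow_le one_lt_two hn⟩
  refine limsup_le_of_eventually_le_of_nonneg hs ?_
  filter_upwards [hlog.eventually h, eventually_ge_atTop 2] with n hn hn2
  have hn0 : (0 : ℝ) < n := by positivity
  have hlogn : 0 < Real.log n := Real.log_pos (by exact_mod_cast hn2)
  have hm := Real.log_le_log (by positivity) (rpow_neg_le_mRand hs (by omega) hn)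
  rw [Real.log_rpow hn0] at hm
  rw [div_neg, neg_le, le_div_iff₀ hlogn]
  exact hm

/-- for a random dynamical system with invariant measure `μ` whose marginal
`ν = (Prod.snd)_*μ` on `X` has positive lower correlation dimension,
`limsup (log mₙ^{ω,ω̃})/(-log n) ≤ 2 / C̲_ν` for `μ ⊗ μ`-almost every `(ω,x,ω̃,x̃)`. -/
theorem shortest_distance_random_orbits_upper
    {Ω : Type*} [MeasurableSpace Ω] {N : ℕ} (X : Set (EuclideanSpace ℝ (Fin N)))
    (θ : Ω → Ω) (Pω : Measure Ω) [IsProbabilityMeasure Pω] (hθ : MeasurePreserving θ Pω Pω)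
    (T : Ω → X → X) (hT : Measurable fun p : Ω × X => T p.1 p.2)
    (μ : Measure (Ω × X)) [IsProbabilityMeasure μ]
    (hS : MeasurePreserving (fun p : Ω × X => (θ p.1, T p.1 p.2)) μ μ)
    (hmarg : μ.map Prod.fst = Pω)
    (hC : 0 < lowerCorrDim (μ.map Prod.snd)) :
    ∀ᵐ q ∂(μ.prod μ),
      Filter.limsup (fun n : ℕ =>
          Real.log (mRand (fun p : Ω × X => (θ p.1, T p.1 p.2)) n q.1 q.2)
            / (-Real.log (n : ℝ)))
        Filter.atTop ≤ 2 / lowerCorrDim (μ.map Prod.snd) := by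
  have hsep (m : ℕ) := ae_eventually_dyadic_le_dist hS measurable_snd
    (s := 2 / lowerCorrDim (μ.map Prod.snd) + 1 / ((m : ℝ) + 1)) (by positivity) (by
      rw [div_lt_iff₀ (by positivity), mul_add, mul_div_cancel₀ _ hC.ne']
      have : 0 < lowerCorrDim (μ.map Prod.snd) * (1 / ((m : ℝ) + 1)) := by positivity
      linarith)
  filter_upwards [ae_all_iff.2 hsep] with q hq
  refine le_of_forall_pos_le_add fun ε hε => ?_
  obtain ⟨m, hm⟩ := exists_nat_one_div_lt hε
  refine (limsup_log_mRand_le (by positivity) (hq m)).trans ?_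
  gcongr
end
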